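/- If a linking of three triangles in ℝ³ is combinatorially isotopic to a Borromean linking of three triangles, then it is itself Borromean. -/

import Mathlib

open scoped Matrix

noncomputable section

/-- A point of 3-space. -/
abbrev Pt : Type := Fin 3 → ℝ

/-- A (non-degenerate) triangle in 3-space, given by three affinely independent vertices. -/
structure Tri where
  A : Pt
  B : Pt
  C : Pt
  indep : AffineIndependent ℝ ![A, B, C]

namespace Tri

/-- The set of vertices of a triangle. -/
def vertexSet (T : Tri) : Set Pt := {T.A, T.B, T.C}

/-- The outline `∂T` of a triangle: the union of the three closed edges. -/
def outline (T : Tri) : Set Pt :=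
  segment ℝ T.A T.B ∪ segment ℝ T.B T.C ∪ segment ℝ T.C T.A

/-- The convex hull `⟨T⟩` of a triangle. -/
def hull (T : Tri) : Set Pt := convexHull ℝ {T.A, T.B, T.C}

end Tri

/-- A family of triangles is a linking if the outlines are pairwise disjoint. -/
def IsLinking {ι : Type*} (T : ι → Tri) : Prop :=
  ∀ i j, i ≠ j → Disjoint (T i).outline (T j).outline

/-- An elementary move replaces one triangle `ABC` of the family by `ABC'`, where `C'` is a
point not on the line `AB` such that `(⟨A,C,C'⟩ ∪ ⟨B,C,C'⟩) ∩ ∂XYZ = ∅` for every other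
triangle `XYZ` of the family. -/
def ElemMove {ι : Type*} (T T' : ι → Tri) : Prop :=
  ∃ (i : ι) (A B C C' : Pt),
    (T i).vertexSet = {A, B, C} ∧
    (T' i).vertexSet = {A, B, C'} ∧
    C' ∉ affineSpan ℝ ({A, B} : Set Pt) ∧
    ∀ j, j ≠ i →
      (convexHull ℝ ({A, C, C'} : Set Pt) ∪ convexHull ℝ ({B, C, C'} : Set Pt))
          ∩ (T j).outline = ∅ ∧
      T' j = T j

/-- Two families of triangles are combinatorially isotopic if one can be obtained from the
other by a finite sequence of elementary moves. -/
def CombIsotopic {ι : Type*} (T T' : ι → Tri) : Prop :=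
  Relation.ReflTransGen ElemMove T T'

/-- A triple of triangles is Borromean if the three convex hulls have a common point and the
triangles can be enumerated `Δ0, Δ1, Δ2` so that each `∂Δj ∩ ⟨Δ_{(j+1) mod 3}⟩` consists of
exactly two points. -/
def IsBorromean (T : Fin 3 → Tri) : Prop :=
  ((T 0).hull ∩ (T 1).hull ∩ (T 2).hull).Nonempty ∧
  ∃ e : Equiv.Perm (Fin 3), ∀ j : Fin 3,
    ∃ P Q : Pt, P ≠ Q ∧ (T (e j)).outline ∩ (T (e (j + 1))).hull = {P, Q}


/-! basic facts -/

theorem aff_combo (g : Pt →ᵃ[ℝ] ℝ) {u v : Pt} {a b : ℝ} (h : a + b = 1) :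
    g (a • u + b • v) = a * g u + b * g v := by
  simpa using Convex.combo_affine_apply (f := g) (x := u) (y := v) h

theorem mem_hull3 {A B C x : Pt} : x ∈ convexHull ℝ ({A, B, C} : Set Pt) ↔
    ∃ p q r : ℝ, 0 ≤ p ∧ 0 ≤ q ∧ 0 ≤ r ∧ p + q + r = 1 ∧ p • A + q • B + r • C = x := by
  constructor
  · intro h
    rw [convexHull_insert (by simp), convexHull_pair] at h
    obtain ⟨y, hy, z, ⟨a, b, ha, hb, hab, rfl⟩, ⟨c, d, hc, hd, hcd, rfl⟩⟩ := mem_convexJoin.1 h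
    simp only [Set.mem_singleton_iff] at hy
    subst hy
    refine ⟨c, d * a, d * b, hc, by positivity, by positivity, ?_, ?_⟩
    · rw [add_assoc, ← mul_add, hab, mul_one, hcd]
    · simp only [smul_add, smul_smul, add_assoc]
  · rintro ⟨p, q, r, hp, hq, hr, h, rfl⟩
    have hA : A ∈ convexHull ℝ ({A, B, C} : Set Pt) := subset_convexHull _ _ (by simp)
    have hB : B ∈ convexHull ℝ ({A, B, C} : Set Pt) := subset_convexHull _ _ (by simp)
    have hC : C ∈ convexHull ℝ ({A, B, C} : Set Pt) := subset_convexHull _ _ (by simp)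
    have := (convex_convexHull ℝ ({A, B, C} : Set Pt)).sum_mem (t := Finset.univ)
      (w := ![p, q, r]) (z := ![A, B, C]) (by intro i _; fin_cases i <;> simpa)
      (by simp [Fin.sum_univ_three, h]) (by intro i _; fin_cases i <;> simpa)
    simpa [Fin.sum_univ_three] using this

theorem aff_combo3 (g : Pt →ᵃ[ℝ] ℝ) {u v w : Pt} {a b c : ℝ} (h : a + b + c = 1) :
    g (a • u + b • v + c • w) = a * g u + b * g v + c * g w := by
  have h1 : a • u + b • v + c • w = b • (v - u) + c • (w - u) + u := by
    have : a = 1 - b - c := by linarith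
    subst this
    ext i; simp; ring
  have h2 : ∀ y : Pt, g y = g.linear y + g 0 := fun y => by
    have := g.map_vadd 0 y
    simpa using this
  have : a = 1 - b - c := by linarith
  subst this
  rw [h1, h2, h2 u, h2 v, h2 w]
  simp; ring

theorem outline_iff (T : Tri) (x : Pt) : x ∈ T.outline ↔
    ∃ u ∈ T.vertexSet, ∃ v ∈ T.vertexSet, x ∈ segment ℝ u v := by
  have hA := left_mem_segment ℝ T.A T.B
  have hB := left_mem_segment ℝ T.B T.C
  have hC := left_mem_segment ℝ T.C T.A
  simp only [Tri.outline, Tri.vertexSet, Set.mem_insert_iff, Set.mem_singleton_iff,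
    exists_eq_or_imp, exists_eq_left, segment_same, Set.mem_union]
  rw [segment_symm ℝ T.B T.A, segment_symm ℝ T.C T.B, segment_symm ℝ T.A T.C]
  constructor
  · tauto
  · rintro (((h | h | h) | (h | h | h) | (h | h | h))) <;> first | tauto | (subst h; tauto)

theorem outline_eq {T : Tri} {A B C : Pt} (h : T.vertexSet = {A, B, C}) :
    T.outline = segment ℝ A B ∪ segment ℝ B C ∪ segment ℝ C A := by
  ext x
  rw [outline_iff, h]
  have hA := left_mem_segment ℝ A B
  have hB := left_mem_segment ℝ B C
  have hC := left_mem_segment ℝ C A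
  simp only [Set.mem_insert_iff, Set.mem_singleton_iff,
    exists_eq_or_imp, exists_eq_left, segment_same, Set.mem_union]
  rw [segment_symm ℝ B A, segment_symm ℝ C B, segment_symm ℝ A C]
  constructor
  · rintro (((h | h | h) | (h | h | h) | (h | h | h))) <;> first | tauto | (subst h; tauto)
  · tauto

theorem hull_eq {T : Tri} {A B C : Pt} (h : T.vertexSet = {A, B, C}) :
    T.hull = convexHull ℝ {A, B, C} := by
  rw [← h]; rfl

theorem outline_sub_hull (T : Tri) : T.outline ⊆ T.hull := by
  intro x hx
  obtain ⟨u, hu, v, hv, h⟩ := (outline_iff T x).1 hx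
  exact (convex_convexHull ℝ _).segment_subset (subset_convexHull _ _ hu)
    (subset_convexHull _ _ hv) h

theorem plane (T : Tri) : ∃ (g : Pt →ᵃ[ℝ] ℝ) (m : Pt → ℝ), Continuous m ∧
    Convex ℝ {x | 0 < m x} ∧ (∀ x, x ∈ T.hull ↔ g x = 0 ∧ 0 ≤ m x) ∧
    (∀ x, x ∈ T.outline ↔ g x = 0 ∧ m x = 0) := by
  obtain ⟨A, B, C, hi⟩ := T
  have hl : LinearIndependent ℝ ![B - A, C - A] := by
    have := (affineIndependent_iff_linearIndependent_vsub ℝ _ (0 : Fin 3)).1 hi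
    have h2 := this.comp (fun i : Fin 2 => (⟨i.succ, Fin.succ_ne_zero i⟩ : {x : Fin 3 // x ≠ 0}))
      (by intro i j h; simpa using h)
    have e : ![B - A, C - A] = (fun i : {x : Fin 3 // x ≠ 0} => ![A, B, C] i -ᵥ ![A, B, C] 0) ∘
        (fun i : Fin 2 => (⟨i.succ, Fin.succ_ne_zero i⟩ : {x : Fin 3 // x ≠ 0})) := by
      ext i j
      fin_cases i <;> simp
    rw [e]; exact h2
  obtain ⟨n, hn⟩ := exists_linearIndependent_cons_of_lt_finrank hl (by simp)
  let b := basisOfLinearIndependentOfCardEqFinrank hn (by simp)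
  have hb0 : b 0 = n := by simp [b]
  have hb1 : b 1 = B - A := by simp [b]
  have hb2 : b 2 = C - A := by simp [b]
  let co : Fin 3 → Pt →ᵃ[ℝ] ℝ := fun i =>
    (b.coord i).toAffineMap.comp (AffineMap.id ℝ Pt - AffineMap.const ℝ Pt A)
  have hco : ∀ i x, co i x = b.coord i (x - A) := fun i x => rfl
  have hrep : ∀ x, x = A + (co 0 x) • n + (co 1 x) • (B - A) + (co 2 x) • (C - A) := by
    intro x
    have := b.sum_repr (x - A)
    rw [Fin.sum_univ_three, hb0, hb1, hb2] at this
    simp only [hco, Module.Basis.coord_apply]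
    rw [add_assoc, add_assoc, ← add_assoc (_ • n), this]; abel
  have hval : ∀ (s t : ℝ) (i : Fin 3), co i (A + s • (B - A) + t • (C - A)) =
      s * (if i = 1 then 1 else 0) + t * (if i = 2 then 1 else 0) := by
    intro s t i
    rw [hco]
    have : A + s • (B - A) + t • (C - A) - A = s • b 1 + t • b 2 := by
      rw [hb1, hb2]; abel
    rw [this]
    simp [Module.Basis.coord_apply, Finsupp.single_apply, eq_comm]
  have hcont : ∀ i, Continuous (co i) := fun i => (co i).continuous_of_finiteDimensional
  refine ⟨co 0, fun x => min (1 - co 1 x - co 2 x) (min (co 1 x) (co 2 x)), ?_, ?_, ?_, ?_⟩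
  · have := hcont 1
    have := hcont 2
    fun_prop
  · intro x hx y hy a c ha hc hac
    simp only [Set.mem_ofPred_eq, lt_min_iff] at hx hy ⊢
    obtain ⟨h1, h2, h3⟩ := hx
    obtain ⟨k1, k2, k3⟩ := hy
    rw [aff_combo _ hac, aff_combo _ hac]
    have pos : ∀ u v : ℝ, 0 < u → 0 < v → 0 < a * u + c * v := by
      intro u v hu hv
      rcases ha.eq_or_lt with h | h
      · subst h; simp at hac; subst hac; simpa
      · positivity
    refine ⟨?_, pos _ _ h2 k2, pos _ _ h3 k3⟩
    have := pos _ _ h1 k1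
    nlinarith
  · intro x
    show x ∈ convexHull ℝ _ ↔ _
    rw [mem_hull3]
    simp only [le_min_iff]
    constructor
    · rintro ⟨p, q, r, hp, hq, hr, h, rfl⟩
      have : p • A + q • B + r • C = A + q • (B - A) + r • (C - A) := by
        have : p = 1 - q - r := by linarith
        subst this; ext i; simp; ring
      rw [this, hval, hval, hval]
      simp
      exact ⟨by linarith, hq, hr⟩
    · rintro ⟨h0, h1, h2, h3⟩
      refine ⟨_, _, _, h1, h2, h3, by ring, ?_⟩
      conv_rhs => rw [hrep x, h0]
      ext i; simp; ring
  · have seg : ∀ (x : Pt) (u v : Pt) (s t : ℝ), 0 ≤ s → 0 ≤ t → s + t = 1 → s • u + t • v = x →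
        x ∈ segment ℝ u v := fun x u v s t h1 h2 h3 h4 => ⟨s, t, h1, h2, h3, h4⟩
    intro x
    constructor
    · rintro ((⟨s, t, hs, ht, h, rfl⟩ | ⟨s, t, hs, ht, h, rfl⟩) | ⟨s, t, hs, ht, h, rfl⟩)
      · have : s • A + t • B = A + t • (B - A) + (0:ℝ) • (C - A) := by
          obtain rfl : s = 1 - t := by linarith
          ext i; simp; ring
        dsimp only at *
        rw [this, hval, hval, hval]; simp [ht]; linarith
      · have : s • B + t • C = A + s • (B - A) + t • (C - A) := by
          obtain rfl : s = 1 - t := by linarith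
          ext i; simp; ring
        dsimp only at *
        rw [this, hval, hval, hval]
        have : 1 - s - t = 0 := by linarith
        simp [this, ht, hs]
      · have : s • C + t • A = A + (0:ℝ) • (B - A) + s • (C - A) := by
          obtain rfl : s = 1 - t := by linarith
          ext i; simp; ring
        dsimp only at *
        rw [this, hval, hval, hval]; simp [hs]; linarith
    · rintro ⟨h0, hm⟩
      dsimp only at hm
      have hx := hrep x
      rw [h0] at hx
      have hge : 0 ≤ min (1 - co 1 x - co 2 x) (min (co 1 x) (co 2 x)) := hm.ge
      simp only [le_min_iff] at hge
      obtain ⟨g1, g2, g3⟩ := hge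
      show (x ∈ segment ℝ A B ∨ x ∈ segment ℝ B C) ∨ x ∈ segment ℝ C A
      generalize co 1 x = s at *
      generalize co 2 x = t at *
      rcases min_choice (1 - s - t) (min s t) with h | h
      · rw [hm] at h
        refine Or.inl (Or.inr (seg _ _ _ s t g2 g3 (by linarith) ?_))
        obtain rfl : s = 1 - t := by linarith
        rw [hx]; ext i; simp; ring
      · rw [hm] at h
        rcases min_choice s t with h' | h'
        · rw [← h] at h'
          subst h'
          refine Or.inr (seg _ _ _ t (1-t) g3 (by linarith) (by ring) ?_)
          rw [hx]; ext i; simp; ring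
        · rw [← h] at h'
          subst h'
          refine Or.inl (Or.inl (seg _ _ _ (1-s) s (by linarith) g2 (by ring) ?_))
          rw [hx]; ext i; simp; ring

structure PD (T : Tri) (g : Pt →ᵃ[ℝ] ℝ) (m : Pt → ℝ) : Prop where
  cont : Continuous m
  conv : Convex ℝ {x | 0 < m x}
  hull : ∀ x, x ∈ T.hull ↔ g x = 0 ∧ 0 ≤ m x
  out : ∀ x, x ∈ T.outline ↔ g x = 0 ∧ m x = 0

theorem exists_PD (T : Tri) : ∃ g m, PD T g m := by
  obtain ⟨g, m, h1, h2, h3, h4⟩ := plane T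
  exact ⟨g, m, h1, h2, h3, h4⟩

theorem seg_zero_of_zero (g : Pt →ᵃ[ℝ] ℝ) {u v z : Pt} (hu : g u = 0) (hv : g v = 0)
    (hz : z ∈ segment ℝ u v) : g z = 0 := by
  obtain ⟨a, b, ha, hb, hab, rfl⟩ := hz
  rw [aff_combo g hab, hu, hv]; simp

theorem ivt {f : Pt → ℝ} (hf : Continuous f) {u v : Pt} (hu : 0 ≤ f u) (hv : f v ≤ 0) :
    ∃ z ∈ segment ℝ u v, f z = 0 := by
  have := (convex_segment (𝕜 := ℝ) u v).isPreconnected.intermediate_value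
    (right_mem_segment ℝ u v) (left_mem_segment ℝ u v) hf.continuousOn
  obtain ⟨z, hz, h⟩ := this ⟨hv, hu⟩
  exact ⟨z, hz, h⟩

theorem seg_ivt (g : Pt →ᵃ[ℝ] ℝ) {u v : Pt} (h : (0 ≤ g u ∧ g v ≤ 0) ∨ (g u ≤ 0 ∧ 0 ≤ g v)) :
    ∃ z ∈ segment ℝ u v, g z = 0 := by
  have hg : Continuous g := g.continuous_of_finiteDimensional
  rcases h with ⟨h1, h2⟩ | ⟨h1, h2⟩
  · exact ivt hg h1 h2
  · rw [segment_symm]; exact ivt hg h2 h1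

theorem PD.prop {T : Tri} {g : Pt →ᵃ[ℝ] ℝ} {m : Pt → ℝ} (h : PD T g m) {x y : Pt}
    (hx : g x = 0) (hy : g y = 0) (hs : ∀ z ∈ segment ℝ x y, z ∉ T.outline)
    (hm : x ∈ T.hull) : y ∈ T.hull := by
  rw [h.hull] at hm ⊢
  refine ⟨hy, ?_⟩
  by_contra hc
  push Not at hc
  obtain ⟨z, hz, h0⟩ := ivt h.cont hm.2 hc.le
  exact hs z hz ((h.out z).2 ⟨seg_zero_of_zero g hx hy hz, h0⟩)

theorem PD.pos {T : Tri} {g : Pt →ᵃ[ℝ] ℝ} {m : Pt → ℝ} (h : PD T g m) {x : Pt}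
    (hx : x ∈ T.hull) (hn : x ∉ T.outline) : 0 < m x := by
  have h1 := (h.hull x).1 hx
  rcases h1.2.eq_or_lt with h2 | h2
  · exact absurd ((h.out x).2 ⟨h1.1, h2.symm⟩) hn
  · exact h2

def OO (A B C : Pt) : Set Pt := segment ℝ A B ∪ segment ℝ B C ∪ segment ℝ C A

theorem OO_rot (A B C : Pt) : OO A B C = OO B C A := by
  ext x; simp only [OO, Set.mem_union]; tauto

theorem OO_swap (A B C : Pt) : OO A B C = OO B A C := by
  ext x; simp only [OO, Set.mem_union, segment_symm ℝ B A, segment_symm ℝ A C,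
    segment_symm ℝ C B]; tauto

theorem chord1 (g : Pt →ᵃ[ℝ] ℝ) {A B C x : Pt} {p q r : ℝ} (hp : 0 ≤ p) (hq : 0 ≤ q) (hr : 0 ≤ r)
    (hs : p + q + r = 1) (hx : p • A + q • B + r • C = x) (gx : g x = 0)
    (hA : 0 ≤ g A) (hB : g B ≤ 0) (hC : g C ≤ 0) :
    ∃ y ∈ OO A B C, ∃ z ∈ OO A B C, g y = 0 ∧ g z = 0 ∧ x ∈ segment ℝ y z := by
  have hv := gx
  rw [← hx, aff_combo3 g hs] at hv
  rcases hA.eq_or_lt with h0 | h0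
  · have hAO : A ∈ OO A B C := Or.inl (Or.inl (left_mem_segment ℝ A B))
    by_cases hqr : q + r = 0
    · have hq0 : q = 0 := by linarith
      have hr0 : r = 0 := by linarith
      have hp1 : p = 1 := by linarith
      subst hq0 hr0 hp1
      have : x = A := by rw [← hx]; simp
      subst this
      exact ⟨x, hAO, x, hAO, gx, gx, by simp⟩
    · have hqp : 0 < q + r := lt_of_le_of_ne (by linarith) (Ne.symm hqr)
      have hone : q / (q + r) + r / (q + r) = 1 := by field_simp
      refine ⟨A, hAO, (q / (q + r)) • B + (r / (q + r)) • C,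
        Or.inl (Or.inr ⟨_, _, by positivity, by positivity, hone, rfl⟩), h0.symm, ?_, ?_⟩
      · rw [aff_combo g hone]
        rw [← h0] at hv
        field_simp
        linarith
      · refine ⟨p, q + r, hp, hqp.le, by linarith, ?_⟩
        rw [← hx, smul_add, smul_smul, smul_smul, mul_div_cancel₀ _ hqr, mul_div_cancel₀ _ hqr,
          add_assoc]
  · have hab : 0 < g A - g B := by linarith
    have hac : 0 < g A - g C := by linarith
    have e1 : -g B / (g A - g B) + g A / (g A - g B) = 1 := by field_simp; ring
    have e2 : g A / (g A - g C) + -g C / (g A - g C) = 1 := by field_simp; ring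
    refine ⟨(-g B / (g A - g B)) • A + (g A / (g A - g B)) • B,
      Or.inl (Or.inl ⟨_, _, div_nonneg (by linarith) hab.le, by positivity, e1, rfl⟩),
      (g A / (g A - g C)) • C + (-g C / (g A - g C)) • A,
      Or.inr ⟨_, _, by positivity, div_nonneg (by linarith) hac.le, e2, rfl⟩, ?_, ?_, ?_⟩
    · rw [aff_combo g e1]; field_simp; ring
    · rw [aff_combo g e2]; field_simp; ring
    · refine ⟨q * (g A - g B) / g A, r * (g A - g C) / g A, by positivity, by positivity, ?_, ?_⟩
      · field_simp; nlinarith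
      · have hp' : p = -(q * g B + r * g C) / g A := by field_simp; linarith
        rw [← hx]
        ext i
        simp
        rw [hp']
        field_simp
        ring

theorem chord (g : Pt →ᵃ[ℝ] ℝ) {A B C x : Pt} (hx : x ∈ convexHull ℝ ({A, B, C} : Set Pt))
    (gx : g x = 0) :
    ∃ y ∈ OO A B C, ∃ z ∈ OO A B C, g y = 0 ∧ g z = 0 ∧ x ∈ segment ℝ y z := by
  obtain ⟨p, q, r, hp, hq, hr, hs, hx⟩ := mem_hull3.1 hx
  have hv := gx
  rw [← hx, aff_combo3 g hs] at hv
  have neg : ∀ y, (-g) y = 0 ↔ g y = 0 := fun y => by simp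
  have cA : (0 ≤ g A ∧ g B ≤ 0 ∧ g C ≤ 0) ∨ (g A ≤ 0 ∧ 0 ≤ g B ∧ 0 ≤ g C) →
      ∃ y ∈ OO A B C, ∃ z ∈ OO A B C, g y = 0 ∧ g z = 0 ∧ x ∈ segment ℝ y z := by
    rintro (⟨h1, h2, h3⟩ | ⟨h1, h2, h3⟩)
    · exact chord1 g hp hq hr hs hx gx h1 h2 h3
    · simpa using chord1 (-g) hp hq hr hs hx (by simpa using gx) (by simpa using h1)
        (by simpa using h2) (by simpa using h3)
  have cB : (0 ≤ g B ∧ g C ≤ 0 ∧ g A ≤ 0) ∨ (g B ≤ 0 ∧ 0 ≤ g C ∧ 0 ≤ g A) →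
      ∃ y ∈ OO A B C, ∃ z ∈ OO A B C, g y = 0 ∧ g z = 0 ∧ x ∈ segment ℝ y z := by
    rw [OO_rot]
    have hx' : q • B + r • C + p • A = x := by rw [← hx]; abel
    rintro (⟨h1, h2, h3⟩ | ⟨h1, h2, h3⟩)
    · exact chord1 g hq hr hp (by linarith) hx' gx h1 h2 h3
    · simpa using chord1 (-g) hq hr hp (by linarith) hx' (by simpa using gx) (by simpa using h1)
        (by simpa using h2) (by simpa using h3)
  have cC : (0 ≤ g C ∧ g A ≤ 0 ∧ g B ≤ 0) ∨ (g C ≤ 0 ∧ 0 ≤ g A ∧ 0 ≤ g B) →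
      ∃ y ∈ OO A B C, ∃ z ∈ OO A B C, g y = 0 ∧ g z = 0 ∧ x ∈ segment ℝ y z := by
    rw [OO_rot, OO_rot]
    have hx' : r • C + p • A + q • B = x := by rw [← hx]; abel
    rintro (⟨h1, h2, h3⟩ | ⟨h1, h2, h3⟩)
    · exact chord1 g hr hp hq (by linarith) hx' gx h1 h2 h3
    · simpa using chord1 (-g) hr hp hq (by linarith) hx' (by simpa using gx) (by simpa using h1)
        (by simpa using h2) (by simpa using h3)
  have key : ∀ a b c p q r : ℝ, 0 ≤ p → 0 ≤ q → 0 ≤ r → p + q + r = 1 →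
      p * a + q * b + r * c = 0 → 0 < a → 0 < b → 0 < c → False := by
    intro a b c p q r hp hq hr hs hv ha hb hc
    have h1 := mul_nonneg hp ha.le
    have h2 := mul_nonneg hq hb.le
    have h3 := mul_nonneg hr hc.le
    have : p = 0 := by
      have : p * a = 0 := by linarith
      rcases mul_eq_zero.1 this with h | h <;> linarith
    have : q = 0 := by
      have : q * b = 0 := by linarith
      rcases mul_eq_zero.1 this with h | h <;> linarith
    have : r = 0 := by
      have : r * c = 0 := by linarith
      rcases mul_eq_zero.1 this with h | h <;> linarith
    linarith
  have k1 := key _ _ _ _ _ _ hp hq hr hs hv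
  have k2 := key (-g A) (-g B) (-g C) _ _ _ hp hq hr hs (by linarith)
  simp only [Left.neg_pos_iff] at k2
  rcases le_or_gt (g A) 0 with h1 | h1 <;> rcases le_or_gt (g B) 0 with h2 | h2 <;>
    rcases le_or_gt (g C) 0 with h3 | h3
  · rcases h1.eq_or_lt with e1 | e1
    · exact cA (Or.inl ⟨e1.ge, h2, h3⟩)
    · rcases h2.eq_or_lt with e2 | e2
      · exact cB (Or.inl ⟨e2.ge, h3, h1⟩)
      · rcases h3.eq_or_lt with e3 | e3
        · exact cC (Or.inl ⟨e3.ge, h1, h2⟩)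
        · exact (k2 e1 e2 e3).elim
  · exact cC (Or.inl ⟨h3.le, h1, h2⟩)
  · exact cB (Or.inl ⟨h2.le, h3, h1⟩)
  · exact cA (Or.inr ⟨h1, h2.le, h3.le⟩)
  · exact cA (Or.inl ⟨h1.le, h2, h3⟩)
  · exact cB (Or.inr ⟨h2, h3.le, h1.le⟩)
  · exact cC (Or.inr ⟨h3, h1.le, h2.le⟩)
  · exact (k1 h1 h2 h3).elim

theorem seg_two_zero (g : Pt →ᵃ[ℝ] ℝ) {u v P Q : Pt} (hP : P ∈ segment ℝ u v)
    (hQ : Q ∈ segment ℝ u v) (hne : P ≠ Q) (gP : g P = 0) (gQ : g Q = 0) : g u = 0 ∧ g v = 0 := by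
  obtain ⟨a, b, ha, hb, hab, rfl⟩ := hP
  obtain ⟨c, d, hc, hd, hcd, rfl⟩ := hQ
  rw [aff_combo g hab] at gP
  rw [aff_combo g hcd] at gQ
  obtain rfl : a = 1 - b := by linarith
  obtain rfl : c = 1 - d := by linarith
  have hbd : b - d ≠ 0 := by
    intro h
    have : b = d := by linarith
    subst this
    exact hne rfl
  have h1 : g v = g u := by
    have : (b - d) * (g v - g u) = 0 := by linarith
    rcases mul_eq_zero.1 this with h | h
    · exact absurd h hbd
    · linarith
  rw [h1] at gP ⊢
  constructor <;> linarith

theorem seg_end (g : Pt →ᵃ[ℝ] ℝ) {u v P : Pt} (hP : P ∈ segment ℝ u v) (gP : g P = 0)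
    (hv : g v = 0) (hu : g u ≠ 0) : P = v := by
  by_contra hne
  exact hu (seg_two_zero g hP (right_mem_segment ℝ u v) hne gP hv).1

theorem seg_sign (g : Pt →ᵃ[ℝ] ℝ) {u v P : Pt} (hP : P ∈ segment ℝ u v) (gP : g P = 0) :
    (0 ≤ g u ∧ g v ≤ 0) ∨ (g u ≤ 0 ∧ 0 ≤ g v) := by
  by_contra hc
  have hc' : (0 < g u ∧ 0 < g v) ∨ (g u < 0 ∧ g v < 0) := by
    rcases lt_trichotomy (g u) 0 with h1 | h1 | h1 <;>
    rcases lt_trichotomy (g v) 0 with h2 | h2 | h2 <;>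
    first
      | exact Or.inl ⟨h1, h2⟩
      | exact Or.inr ⟨h1, h2⟩
      | exact (hc (Or.inl ⟨by linarith, by linarith⟩)).elim
      | exact (hc (Or.inr ⟨by linarith, by linarith⟩)).elim
  obtain ⟨a, b, ha, hb, hab, rfl⟩ := hP
  rw [aff_combo g hab] at gP
  obtain rfl : a = 1 - b := by linarith
  rcases hc' with ⟨h1, h2⟩ | ⟨h1, h2⟩
  · have := mul_nonneg ha h1.le
    have := mul_nonneg hb h2.le
    have h3 : b * g v = 0 := by linarith
    rcases mul_eq_zero.1 h3 with h | h
    · subst h; simp at gP; linarith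
    · linarith
  · have := mul_nonneg ha (neg_nonneg.2 h1.le)
    have := mul_nonneg hb (neg_nonneg.2 h2.le)
    have h3 : b * g v = 0 := by linarith
    rcases mul_eq_zero.1 h3 with h | h
    · subst h; simp at gP; linarith
    · linarith

theorem two_core (g : Pt →ᵃ[ℝ] ℝ) (K : Set Pt) {A B C P Q x : Pt}
    (st : ∀ u v, segment ℝ u v ⊆ OO A B C → ∀ x ∈ segment ℝ u v, ∀ y ∈ segment ℝ u v,
      g x = 0 → g y = 0 → y ∈ K → x ∈ K)
    (hP : P ∈ OO A B C) (hQ : Q ∈ OO A B C) (hne : P ≠ Q) (gP : g P = 0) (gQ : g Q = 0)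
    (kP : P ∈ K) (kQ : Q ∈ K) (hx : x ∈ segment ℝ C A) (gx : g x = 0) : x ∈ K := by
  have s1 := st A B (fun z hz => Or.inl (Or.inl hz))
  have s2 := st B C (fun z hz => Or.inl (Or.inr hz))
  have s3 := st C A (fun z hz => Or.inr hz)
  have viaA : ∀ P ∈ segment ℝ A B, g P = 0 → P ∈ K → g A = 0 → x ∈ K := fun P h1 h2 h3 h4 =>
    s3 x hx A (right_mem_segment ℝ C A) gx h4 (s1 A (left_mem_segment ℝ A B) P h1 h4 h2 h3)
  have viaC : ∀ P ∈ segment ℝ B C, g P = 0 → P ∈ K → g C = 0 → x ∈ K := fun P h1 h2 h3 h4 =>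
    s3 x hx C (left_mem_segment ℝ C A) gx h4 (s2 C (right_mem_segment ℝ B C) P h1 h4 h2 h3)
  have mix : ∀ P ∈ segment ℝ A B, ∀ Q ∈ segment ℝ B C, P ≠ Q → g P = 0 → g Q = 0 → P ∈ K →
      Q ∈ K → x ∈ K := by
    intro P hP Q hQ hne gP gQ kP kQ
    by_cases hA : g A = 0
    · exact viaA P hP gP kP hA
    by_cases hC : g C = 0
    · exact viaC Q hQ gQ kQ hC
    exfalso
    by_cases hB : g B = 0
    · apply hne
      rw [seg_end g hP gP hB hA]
      rw [segment_symm] at hQ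
      rw [seg_end g hQ gQ hB hC]
    · have t1 := seg_sign g hP gP
      have t2 := seg_sign g hQ gQ
      have t3 := seg_sign g hx gx
      rcases lt_or_gt_of_ne hA with a | a <;> rcases lt_or_gt_of_ne hB with b | b <;>
        rcases lt_or_gt_of_ne hC with c | c <;>
        rcases t1 with ⟨t, t'⟩ | ⟨t, t'⟩ <;> rcases t2 with ⟨u, u'⟩ | ⟨u, u'⟩ <;>
        rcases t3 with ⟨v, v'⟩ | ⟨v, v'⟩ <;> linarith
  rcases hP with (hP | hP) | hP
  · rcases hQ with (hQ | hQ) | hQ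
    · exact viaA P hP gP kP (seg_two_zero g hP hQ hne gP gQ).1
    · exact mix P hP Q hQ hne gP gQ kP kQ
    · exact s3 x hx Q hQ gx gQ kQ
  · rcases hQ with (hQ | hQ) | hQ
    · exact mix Q hQ P hP hne.symm gQ gP kQ kP
    · exact viaC P hP gP kP (seg_two_zero g hP hQ hne gP gQ).2
    · exact s3 x hx Q hQ gx gQ kQ
  · exact s3 x hx P hP gx gP kP

theorem two_sub {S T : Tri} {g : Pt →ᵃ[ℝ] ℝ} {m : Pt → ℝ} (h : PD T g m)
    (hd : Disjoint S.outline T.outline) {P Q : Pt} (hne : P ≠ Q)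
    (hPQ : S.outline ∩ T.hull = {P, Q}) {x : Pt} (hx : x ∈ S.outline) (gx : g x = 0) :
    x ∈ T.hull := by
  have hP : P ∈ S.outline ∩ T.hull := by rw [hPQ]; simp
  have hQ : Q ∈ S.outline ∩ T.hull := by rw [hPQ]; simp
  have gP := ((h.hull P).1 hP.2).1
  have gQ := ((h.hull Q).1 hQ.2).1
  have st : ∀ u v, segment ℝ u v ⊆ S.outline → ∀ x ∈ segment ℝ u v, ∀ y ∈ segment ℝ u v,
      g x = 0 → g y = 0 → y ∈ T.hull → x ∈ T.hull := by
    intro u v huv x hx y hy gx gy ky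
    refine h.prop gy gx ?_ ky
    intro z hz hzT
    exact Set.disjoint_left.1 hd (huv ((convex_segment u v).segment_subset hy hx hz)) hzT
  have e0 : S.outline = OO S.A S.B S.C := rfl
  have e1 : S.outline = OO S.B S.C S.A := by rw [e0, OO_rot]
  have e2 : S.outline = OO S.C S.A S.B := by rw [e1, OO_rot]
  rcases hx with (hx | hx) | hx
  · rw [e1] at st hP hQ
    exact two_core g _ st hP.1 hQ.1 hne gP gQ hP.2 hQ.2 hx gx
  · rw [e2] at st hP hQ
    exact two_core g _ st hP.1 hQ.1 hne gP gQ hP.2 hQ.2 hx gx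
  · rw [e0] at st hP hQ
    exact two_core g _ st hP.1 hQ.1 hne gP gQ hP.2 hQ.2 hx gx

theorem W_of_out {S T : Tri} {g : Pt →ᵃ[ℝ] ℝ} {m : Pt → ℝ} (h : PD T g m)
    (ho : ∀ x ∈ S.outline, g x = 0 → 0 < m x) : ∀ x ∈ S.hull, g x = 0 → 0 < m x := by
  intro x hx gx
  obtain ⟨y, hy, z, hz, gy, gz, hs⟩ := chord g hx gx
  exact h.conv.segment_subset (ho y hy gy) (ho z hz gz) hs

theorem W_of_two {S T : Tri} {g : Pt →ᵃ[ℝ] ℝ} {m : Pt → ℝ} (h : PD T g m)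
    (hd : Disjoint S.outline T.outline) {P Q : Pt} (hne : P ≠ Q)
    (hPQ : S.outline ∩ T.hull = {P, Q}) : ∀ x ∈ S.hull, g x = 0 → 0 < m x :=
  W_of_out h fun _ hx gx => h.pos (two_sub h hd hne hPQ hx gx) (Set.disjoint_left.1 hd hx)

theorem hull_pos (g : Pt →ᵃ[ℝ] ℝ) {A B C x : Pt} (hx : x ∈ convexHull ℝ ({A, B, C} : Set Pt))
    (hA : 0 < g A) (hB : 0 < g B) (hC : 0 < g C) : 0 < g x := by
  have hc : Convex ℝ {y | 0 < g y} := by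
    have := (convex_Ioi (0:ℝ)).affine_preimage g
    exact this
  refine convexHull_min ?_ hc hx
  rintro y (rfl | rfl | rfl) <;> assumption

theorem hull_nonneg (g : Pt →ᵃ[ℝ] ℝ) {A B C x : Pt} (hx : x ∈ convexHull ℝ ({A, B, C} : Set Pt))
    (hA : 0 ≤ g A) (hB : 0 ≤ g B) (hC : 0 ≤ g C) : 0 ≤ g x := by
  have hc : Convex ℝ {y | 0 ≤ g y} := by
    have := (convex_Ici (0:ℝ)).affine_preimage g
    exact this
  refine convexHull_min ?_ hc hx
  rintro y (rfl | rfl | rfl) <;> assumption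

theorem propC_core (g : Pt →ᵃ[ℝ] ℝ) (Q : Pt → Prop) {A B C C' : Pt} {F : Set Pt}
    (hF1 : convexHull ℝ {A, C, C'} ⊆ F) (hF2 : convexHull ℝ {B, C, C'} ⊆ F)
    (hQ : ∀ x y, segment ℝ x y ⊆ F → g x = 0 → g y = 0 → Q x → Q y)
    (hns : ¬ (0 < g A ∧ 0 < g B ∧ 0 < g C))
    (base : ∀ y ∈ segment ℝ A C ∪ segment ℝ B C, g y = 0 → Q y) {x : Pt}
    (hx : x ∈ convexHull ℝ {A, C, C'}) (gx : g x = 0) (hc : 0 ≤ g C) : Q x := by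
  have c1 := convex_convexHull ℝ ({A, C, C'} : Set Pt)
  have c2 := convex_convexHull ℝ ({B, C, C'} : Set Pt)
  have mA : A ∈ convexHull ℝ ({A, C, C'} : Set Pt) := subset_convexHull _ _ (by simp)
  have mC : C ∈ convexHull ℝ ({A, C, C'} : Set Pt) := subset_convexHull _ _ (by simp)
  have mC' : C' ∈ convexHull ℝ ({A, C, C'} : Set Pt) := subset_convexHull _ _ (by simp)
  have nB : B ∈ convexHull ℝ ({B, C, C'} : Set Pt) := subset_convexHull _ _ (by simp)
  have nC : C ∈ convexHull ℝ ({B, C, C'} : Set Pt) := subset_convexHull _ _ (by simp)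
  have nC' : C' ∈ convexHull ℝ ({B, C, C'} : Set Pt) := subset_convexHull _ _ (by simp)
  by_cases hz : ∃ z ∈ segment ℝ A C, g z = 0
  · obtain ⟨z, hz, gz⟩ := hz
    exact hQ z x ((c1.segment_subset (c1.segment_subset mA mC hz) hx).trans hF1) gz gx
      (base z (Or.inl hz) gz)
  · have hA : 0 < g A := by
      by_contra h
      exact hz (seg_ivt g (Or.inr ⟨not_lt.1 h, hc⟩))
    have hC : 0 < g C := by
      by_contra h
      exact hz (seg_ivt g (Or.inl ⟨hA.le, not_lt.1 h⟩))
    have hB : g B ≤ 0 := by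
      by_contra h
      exact hns ⟨hA, not_le.1 h, hC⟩
    have hC' : g C' ≤ 0 := by
      by_contra h
      have := hull_pos g hx hA hC (not_le.1 h)
      linarith
    obtain ⟨w, hw, gw⟩ := seg_ivt g (Or.inl ⟨hC.le, hC'⟩)
    obtain ⟨y, hy, gy⟩ := seg_ivt g (Or.inr ⟨hB, hC.le⟩)
    have q1 := base y (Or.inr hy) gy
    have q2 := hQ y w ((c2.segment_subset (c2.segment_subset nB nC hy)
      (c2.segment_subset nC nC' hw)).trans hF2) gy gw q1
    exact hQ w x ((c1.segment_subset (c1.segment_subset mC mC' hw) hx).trans hF1) gw gx q2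

def FF (A B C C' : Pt) : Set Pt := convexHull ℝ {A, C, C'} ∪ convexHull ℝ {B, C, C'}

theorem FF_swap (A B C C' : Pt) : FF A B C C' = FF A B C' C := by
  unfold FF; rw [Set.pair_comm C C']

theorem propC (g : Pt →ᵃ[ℝ] ℝ) (Q : Pt → Prop) {A B C C' : Pt}
    (hQ : ∀ x y, segment ℝ x y ⊆ FF A B C C' → g x = 0 → g y = 0 → Q x → Q y)
    (hns : ¬ (0 < g A ∧ 0 < g B ∧ 0 < g C)) (hns' : ¬ (g A < 0 ∧ g B < 0 ∧ g C < 0))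
    (base : ∀ y ∈ segment ℝ A C ∪ segment ℝ B C, g y = 0 → Q y) {x : Pt}
    (hx : x ∈ FF A B C C') (gx : g x = 0) : Q x := by
  have hF1 : convexHull ℝ {A, C, C'} ⊆ FF A B C C' := Set.subset_union_left
  have hF2 : convexHull ℝ {B, C, C'} ⊆ FF A B C C' := Set.subset_union_right
  have base' : ∀ y ∈ segment ℝ B C ∪ segment ℝ A C, g y = 0 → Q y := by
    rw [Set.union_comm]; exact base
  rcases le_total 0 (g C) with hc | hc <;> rcases hx with hx | hx
  · exact propC_core g Q hF1 hF2 hQ hns base hx gx hc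
  · exact propC_core g Q hF2 hF1 hQ (by tauto) base' hx gx hc
  · exact propC_core (-g) Q hF1 hF2 (by simpa using hQ) (by simpa using hns')
      (by simpa using base) hx (by simpa using gx) (by simpa using hc)
  · exact propC_core (-g) Q hF2 hF1 (by simpa using hQ) (by
        intro hh; simp at hh; exact hns' ⟨hh.2.1, hh.1, hh.2.2⟩)
      (by simpa using base') hx (by simpa using gx) (by simpa using hc)

theorem seg_inter {A B C x : Pt} (h : AffineIndependent ℝ ![A, B, C]) (h1 : x ∈ segment ℝ A B)
    (h2 : x ∈ segment ℝ B C) : x = B := by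
  obtain ⟨a, b, ha, hb, hab, rfl⟩ := h1
  obtain ⟨c, d, hc, hd, hcd, he⟩ := h2
  have := affineIndependent_iff.1 h Finset.univ ![a, b - c, -d]
    (by simp [Fin.sum_univ_three]; linarith)
    (by
      simp only [Fin.sum_univ_three, Matrix.cons_val]
      rw [sub_smul, neg_smul]
      calc _ = a • A + b • B - (c • B + d • C) := by abel
        _ = 0 := by rw [he, sub_self]) 0 (Finset.mem_univ _)
  simp at this
  subst this
  simp at hab
  subst hab
  simp

theorem mixed0 (g : Pt →ᵃ[ℝ] ℝ) {A B C : Pt} (h : AffineIndependent ℝ ![A, B, C])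
    (hA : 0 < g A) (hB : g B < 0) (hC : 0 ≤ g C) :
    ∃ P Q, P ≠ Q ∧ OO A B C ∩ {x | g x = 0} = {P, Q} := by
  obtain ⟨P, hP, gP⟩ := seg_ivt g (Or.inl ⟨hA.le, hB.le⟩)
  obtain ⟨Q, hQ, gQ⟩ := seg_ivt g (Or.inr ⟨hB.le, hC⟩)
  refine ⟨P, Q, ?_, ?_⟩
  · rintro rfl
    rw [seg_inter h hP hQ] at gP
    linarith
  · ext x
    simp only [Set.mem_inter_iff, Set.mem_ofPred_eq, Set.mem_insert_iff, Set.mem_singleton_iff]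
    have uQ : ∀ y ∈ segment ℝ B C, g y = 0 → y = Q := by
      intro y hy gy
      by_contra hne
      have := (seg_two_zero g hy hQ hne gy gQ).1
      linarith
    constructor
    · rintro ⟨(hx | hx) | hx, gx⟩
      · left
        by_contra hne
        have := (seg_two_zero g hx hP hne gx gP).1
        linarith
      · exact Or.inr (uQ x hx gx)
      · have hC0 : g C = 0 := by
          rcases seg_sign g hx gx with h | h <;> linarith [h.1, h.2]
        rw [segment_symm] at hx
        have := seg_end g hx gx hC0 hA.ne'
        subst this
        exact Or.inr (uQ x (right_mem_segment ℝ B x) gx)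
    · rintro (rfl | rfl)
      · exact ⟨Or.inl (Or.inl hP), gP⟩
      · exact ⟨Or.inl (Or.inr hQ), gQ⟩

theorem indep_swap {A B C : Pt} (h : AffineIndependent ℝ ![A, B, C]) :
    AffineIndependent ℝ ![B, A, C] := by
  have := h.comp_embedding (Equiv.swap (0 : Fin 3) 1).toEmbedding
  convert this using 1
  funext i; fin_cases i <;> rfl

theorem indep_rot {A B C : Pt} (h : AffineIndependent ℝ ![A, B, C]) :
    AffineIndependent ℝ ![B, C, A] := by
  have := h.comp_embedding (finRotate 3).toEmbedding
  convert this using 1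
  funext i; fin_cases i <;> rfl

theorem mixed1 (g : Pt →ᵃ[ℝ] ℝ) {A B C : Pt} (h : AffineIndependent ℝ ![A, B, C])
    (hA : 0 < g A) (hB : g B < 0) :
    ∃ P Q, P ≠ Q ∧ OO A B C ∩ {x | g x = 0} = {P, Q} := by
  rcases le_total 0 (g C) with hC | hC
  · exact mixed0 g h hA hB hC
  · rw [OO_swap]
    simpa using mixed0 (-g) (indep_swap h) (by simpa using hB) (by simpa using hA)
      (by simpa using hC)

theorem mixed (S : Tri) (g : Pt →ᵃ[ℝ] ℝ)
    (h1 : ¬ (0 ≤ g S.A ∧ 0 ≤ g S.B ∧ 0 ≤ g S.C)) (h2 : ¬ (g S.A ≤ 0 ∧ g S.B ≤ 0 ∧ g S.C ≤ 0)) :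
    ∃ P Q, P ≠ Q ∧ S.outline ∩ {x | g x = 0} = {P, Q} := by
  obtain ⟨A, B, C, h⟩ := S
  simp only at h1 h2
  change ∃ P Q, P ≠ Q ∧ OO A B C ∩ {x | g x = 0} = {P, Q}
  have r1 := indep_rot h
  have r2 := indep_rot r1
  have mAB := mixed1 g h
  have mBC := mixed1 g r1
  have mCA := mixed1 g r2
  have mBA := mixed1 g (indep_swap h)
  have mCB := mixed1 g (indep_swap r1)
  have mAC := mixed1 g (indep_swap r2)
  rw [← OO_swap] at mBA mCB mAC
  rw [← OO_rot] at mBC mCB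
  rw [← OO_rot, ← OO_rot] at mCA mAC
  have n : (g A < 0 ∨ g B < 0 ∨ g C < 0) := by
    by_contra hc; push Not at hc; exact h1 hc
  have p : (0 < g A ∨ 0 < g B ∨ 0 < g C) := by
    by_contra hc; push Not at hc; exact h2 hc
  rcases n with n | n | n <;> rcases p with p | p | p <;>
    first
      | exact absurd n (not_lt.2 p.le)
      | exact mAB p n
      | exact mBC p n
      | exact mCA p n
      | exact mBA p n
      | exact mCB p n
      | exact mAC p n

theorem mixed_hull (S : Tri) (g : Pt →ᵃ[ℝ] ℝ) {y z : Pt} (hy : y ∈ S.hull) (hz : z ∈ S.hull)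
    (gy : g y < 0) (gz : 0 < g z) : ∃ P Q, P ≠ Q ∧ S.outline ∩ {x | g x = 0} = {P, Q} := by
  apply mixed
  · rintro ⟨a, b, c⟩
    have := hull_nonneg g hy a b c
    linarith
  · rintro ⟨a, b, c⟩
    have := hull_nonneg (-g) hz (by simpa using a) (by simpa using b) (by simpa using c)
    simp at this
    linarith

/-- interior zero with weakly constant sign forces vanishing on the triangle -/
theorem flat_of_nonneg (S : Tri) (g : Pt →ᵃ[ℝ] ℝ) {x : Pt} (hx : x ∈ S.hull) (hn : x ∉ S.outline)
    (gx : g x = 0) (hA : 0 ≤ g S.A) (hB : 0 ≤ g S.B) (hC : 0 ≤ g S.C) :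
    ∀ y ∈ S.hull, g y = 0 := by
  obtain ⟨p, q, r, hp, hq, hr, hs, rfl⟩ := mem_hull3.1 hx
  rw [aff_combo3 g hs] at gx
  have hp0 : p ≠ 0 := by
    rintro rfl
    exact hn (Or.inl (Or.inr ⟨q, r, hq, hr, by linarith, by simp⟩))
  have hq0 : q ≠ 0 := by
    rintro rfl
    exact hn (Or.inr ⟨r, p, hr, hp, by linarith, by simp [add_comm]⟩)
  have hr0 : r ≠ 0 := by
    rintro rfl
    exact hn (Or.inl (Or.inl ⟨p, q, hp, hq, by linarith, by simp⟩))
  have h1 := mul_nonneg hp hA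
  have h2 := mul_nonneg hq hB
  have h3 := mul_nonneg hr hC
  have zA : g S.A = 0 := (mul_eq_zero.1 (by linarith : p * g S.A = 0)).resolve_left hp0
  have zB : g S.B = 0 := (mul_eq_zero.1 (by linarith : q * g S.B = 0)).resolve_left hq0
  have zC : g S.C = 0 := (mul_eq_zero.1 (by linarith : r * g S.C = 0)).resolve_left hr0
  intro y hy
  obtain ⟨p, q, r, hp, hq, hr, hs, rfl⟩ := mem_hull3.1 hy
  rw [aff_combo3 g hs, zA, zB, zC]; simp

theorem nonvanish_neg (g : Pt →ᵃ[ℝ] ℝ) {x y : Pt} (h : ∀ z ∈ segment ℝ x y, g z ≠ 0) :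
    g x < 0 ↔ g y < 0 := by
  constructor
  · intro hx
    by_contra hy
    obtain ⟨z, hz, gz⟩ := seg_ivt g (Or.inr ⟨hx.le, not_lt.1 hy⟩)
    exact h z hz gz
  · intro hy
    by_contra hx
    obtain ⟨z, hz, gz⟩ := seg_ivt g (Or.inl ⟨not_lt.1 hx, hy.le⟩)
    exact h z hz gz

/-- key step -/
theorem step {T0 T0' T1 T2 : Tri} {A B C C' : Pt} (h0 : T0.vertexSet = {A, B, C})
    (h0' : T0'.vertexSet = {A, B, C'})
    (hF1 : ∀ x ∈ FF A B C C', x ∉ T1.outline) (hF2 : ∀ x ∈ FF A B C C', x ∉ T2.outline)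
    (d01 : Disjoint T0.outline T1.outline) (d12 : Disjoint T1.outline T2.outline)
    (d20 : Disjoint T2.outline T0.outline)
    (hO : (T0.hull ∩ T1.hull ∩ T2.hull).Nonempty)
    (p01 : ∃ P Q, P ≠ Q ∧ T0.outline ∩ T1.hull = {P, Q})
    (p12 : ∃ P Q, P ≠ Q ∧ T1.outline ∩ T2.hull = {P, Q})
    (p20 : ∃ P Q, P ≠ Q ∧ T2.outline ∩ T0.hull = {P, Q}) :
    (T0'.hull ∩ T1.hull ∩ T2.hull).Nonempty ∧
    (∃ P Q, P ≠ Q ∧ T0'.outline ∩ T1.hull = {P, Q}) ∧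
    (∃ P Q, P ≠ Q ∧ T2.outline ∩ T0'.hull = {P, Q}) := by
  obtain ⟨g0, m0, D0⟩ := exists_PD T0
  obtain ⟨g0', m0', D0'⟩ := exists_PD T0'
  obtain ⟨g1, m1, D1⟩ := exists_PD T1
  obtain ⟨g2, m2, D2⟩ := exists_PD T2
  obtain ⟨_, _, ne01, e01⟩ := p01
  obtain ⟨U, V, ne12, e12⟩ := p12
  obtain ⟨_, _, ne20, e20⟩ := p20
  have W01 := W_of_two D1 d01 ne01 e01
  have W12 := W_of_two D2 d12 ne12 e12
  have W20 := W_of_two D0 d20 ne20 e20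
  obtain ⟨O, ⟨O0, O1⟩, O2⟩ := hO
  have gO1 := ((D1.hull O).1 O1).1
  have gO2 := ((D2.hull O).1 O2).1
  have eo := outline_eq h0
  have eo' := outline_eq h0'
  have eh := hull_eq h0
  have hABo : segment ℝ A B ⊆ T0.outline := by
    rw [eo]; exact fun z hz => Or.inl (Or.inl hz)
  have hBCo : segment ℝ B C ⊆ T0.outline := by
    rw [eo]; exact fun z hz => Or.inl (Or.inr hz)
  have hACo : segment ℝ A C ⊆ T0.outline := by
    rw [eo, segment_symm]; exact fun z hz => Or.inr hz
  have hABo' : segment ℝ A B ⊆ T0'.outline := by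
    rw [eo']; exact fun z hz => Or.inl (Or.inl hz)
  have hBCo' : segment ℝ B C' ⊆ T0'.outline := by
    rw [eo']; exact fun z hz => Or.inl (Or.inr hz)
  have hACo' : segment ℝ A C' ⊆ T0'.outline := by
    rw [eo', segment_symm]; exact fun z hz => Or.inr hz
  have c1 := convex_convexHull ℝ ({A, C, C'} : Set Pt)
  have c2 := convex_convexHull ℝ ({B, C, C'} : Set Pt)
  have mA : A ∈ convexHull ℝ ({A, C, C'} : Set Pt) := subset_convexHull _ _ (by simp)
  have mC : C ∈ convexHull ℝ ({A, C, C'} : Set Pt) := subset_convexHull _ _ (by simp)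
  have mC' : C' ∈ convexHull ℝ ({A, C, C'} : Set Pt) := subset_convexHull _ _ (by simp)
  have nB : B ∈ convexHull ℝ ({B, C, C'} : Set Pt) := subset_convexHull _ _ (by simp)
  have nC : C ∈ convexHull ℝ ({B, C, C'} : Set Pt) := subset_convexHull _ _ (by simp)
  have nC' : C' ∈ convexHull ℝ ({B, C, C'} : Set Pt) := subset_convexHull _ _ (by simp)
  have fAC' : segment ℝ A C' ⊆ FF A B C C' := (c1.segment_subset mA mC').trans Set.subset_union_left
  have fAC : segment ℝ A C ⊆ FF A B C C' := (c1.segment_subset mA mC).trans Set.subset_union_left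
  have fBC' : segment ℝ B C' ⊆ FF A B C C' :=
    (c2.segment_subset nB nC').trans Set.subset_union_right
  have fBC : segment ℝ B C ⊆ FF A B C C' :=
    (c2.segment_subset nB nC).trans Set.subset_union_right
  have out_cases : ∀ x ∈ T0.outline, x ∈ segment ℝ A B ∨ x ∈ FF A B C C' := by
    intro x hx
    rw [eo] at hx
    rcases hx with (hx | hx) | hx
    · exact Or.inl hx
    · exact Or.inr (fBC hx)
    · rw [segment_symm] at hx; exact Or.inr (fAC hx)
  have out_cases' : ∀ x ∈ T0'.outline, x ∈ segment ℝ A B ∨ x ∈ FF A B C C' := by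
    intro x hx
    rw [eo'] at hx
    rcases hx with (hx | hx) | hx
    · exact Or.inl hx
    · exact Or.inr (fBC' hx)
    · rw [segment_symm] at hx; exact Or.inr (fAC' hx)
  have nopos : ∀ g : Pt →ᵃ[ℝ] ℝ, g O = 0 → ¬ (0 < g A ∧ 0 < g B ∧ 0 < g C) := by
    rintro g hg ⟨a, b, c⟩
    rw [eh] at O0
    have := hull_pos g O0 a b c
    linarith
  have noneg : ∀ g : Pt →ᵃ[ℝ] ℝ, g O = 0 → ¬ (g A < 0 ∧ g B < 0 ∧ g C < 0) := by
    rintro g hg ⟨a, b, c⟩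
    exact nopos (-g) (by simpa using hg) ⟨by simpa using a, by simpa using b, by simpa using c⟩
  -- step 1
  have out1 : ∀ x ∈ T0.outline, g1 x = 0 → x ∈ T1.hull := fun x hx gx =>
    (D1.hull x).2 ⟨gx, (W01 x (outline_sub_hull _ hx) gx).le⟩
  have F1 : ∀ x ∈ FF A B C C', g1 x = 0 → x ∈ T1.hull := by
    intro x hx gx
    refine propC g1 (fun z => z ∈ T1.hull) ?_ (nopos g1 gO1) (noneg g1 gO1) ?_ hx gx
    · intro x y hs hx hy hm
      exact D1.prop hx hy (fun z hz => hF1 z (hs hz)) hm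
    · rintro y (hy | hy) gy
      · exact out1 y (hACo hy) gy
      · exact out1 y (hBCo hy) gy
  have W01' : ∀ x ∈ T0'.hull, g1 x = 0 → 0 < m1 x := by
    refine W_of_out D1 ?_
    intro x hx gx
    rcases out_cases' x hx with h | h
    · exact W01 x (outline_sub_hull _ (hABo h)) gx
    · exact D1.pos (F1 x h gx) (hF1 x h)
  -- step 2
  have out2 : ∀ x ∈ T0.outline, x ∉ T2.hull := by
    intro x hx h2
    have := (D0.out x).1 hx
    have := W20 x h2 this.1
    linarith
  have F2 : ∀ x ∈ FF A B C C', x ∉ T2.hull := by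
    intro x hx hx2
    have gx := ((D2.hull x).1 hx2).1
    refine propC g2 (fun z => z ∉ T2.hull) ?_ (nopos g2 gO2) (noneg g2 gO2) ?_ hx gx hx2
    · intro x y hs hx hy hm hn
      apply hm
      refine D2.prop hy hx (fun z hz => hF2 z (hs ?_)) hn
      rwa [segment_symm] at hz
    · rintro y (hy | hy) gy
      · exact out2 y (hACo hy)
      · exact out2 y (hBCo hy)
  have out2' : ∀ x ∈ T0'.outline, x ∉ T2.hull := by
    intro x hx
    rcases out_cases' x hx with h | h
    · exact out2 x (hABo h)
    · exact F2 x h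
  -- step 3
  have F12 : ∀ x ∈ FF A B C C', g2 x = 0 → g1 x ≠ 0 := by
    intro x hx gx2 gx1
    exact F2 x hx ((D2.hull x).2 ⟨gx2, (W12 x (F1 x hx gx1) gx2).le⟩)
  have sgn : ∀ x y, segment ℝ x y ⊆ FF A B C C' → g2 x = 0 → g2 y = 0 →
      (g1 x < 0 ↔ g1 y < 0) := by
    intro x y hs hx hy
    exact nonvanish_neg g1 fun z hz => F12 z (hs hz) (seg_zero_of_zero g2 hx hy hz)
  -- step 4
  have ex : ∃ y ∈ T0.outline, ∃ z ∈ T0.outline, g2 y = 0 ∧ g2 z = 0 ∧ g1 y < 0 ∧ 0 < g1 z := by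
    obtain ⟨y, hy, z, hz, gy, gz, hs⟩ := chord g2 O0 gO2
    have hy : y ∈ T0.outline := hy
    have hz : z ∈ T0.outline := hz
    have nz : ∀ y ∈ T0.outline, g2 y = 0 → g1 y ≠ 0 := by
      intro y hy gy g1y
      exact out2 y hy ((D2.hull y).2 ⟨gy, (W12 y (out1 y hy g1y) gy).le⟩)
    have hy1 := nz y hy gy
    have hz1 := nz z hz gz
    rcases seg_sign g1 hs gO1 with ⟨a, b⟩ | ⟨a, b⟩
    · exact ⟨z, hz, y, hy, gz, gy, lt_of_le_of_ne b hz1, lt_of_le_of_ne a hy1.symm⟩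
    · exact ⟨y, hy, z, hz, gy, gz, lt_of_le_of_ne a hy1, lt_of_le_of_ne b hz1.symm⟩
  obtain ⟨y, hy, z, hz, gy, gz, g1y, g1z⟩ := ex
  -- the new triangle is not strictly on one side
  have bad : ¬ ((0 < g2 A ∧ 0 < g2 B ∧ 0 < g2 C') ∨ (g2 A < 0 ∧ g2 B < 0 ∧ g2 C' < 0)) := by
    intro hbad
    have hAB : ∀ x ∈ segment ℝ A B, g2 x ≠ 0 := by
      intro x hx gx
      rcases seg_sign g2 hx gx with ⟨a, b⟩ | ⟨a, b⟩ <;> rcases hbad with h | h <;>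
        linarith [h.1, h.2.1]
    have side : ∀ x ∈ T0.outline, g2 x = 0 → x ∈ segment ℝ A C ∨ x ∈ segment ℝ B C := by
      intro x hx gx
      rw [eo] at hx
      rcases hx with (hx | hx) | hx
      · exact absurd gx (hAB x hx)
      · exact Or.inr hx
      · rw [segment_symm] at hx; exact Or.inl hx
    have hw : ∃ w ∈ segment ℝ C C', g2 w = 0 := by
      apply seg_ivt
      rcases side y hy gy with h | h <;> rcases seg_sign g2 h gy with ⟨a, b⟩ | ⟨a, b⟩ <;>
      rcases hbad with ⟨h1, h2, h3⟩ | ⟨h1, h2, h3⟩ <;>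
      first
        | (exfalso; linarith)
        | exact Or.inl ⟨by linarith, by linarith⟩
        | exact Or.inr ⟨by linarith, by linarith⟩
    obtain ⟨w, hw, gw⟩ := hw
    have conn : ∀ x ∈ T0.outline, g2 x = 0 → (g1 x < 0 ↔ g1 w < 0) := by
      intro x hx gx
      apply sgn x w _ gx gw
      rcases side x hx gx with h | h
      · exact (c1.segment_subset (c1.segment_subset mA mC h)
          (c1.segment_subset mC mC' hw)).trans Set.subset_union_left
      · exact (c2.segment_subset (c2.segment_subset nB nC h)
          (c2.segment_subset nC nC' hw)).trans Set.subset_union_right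
    have := (conn z hz gz).2 ((conn y hy gy).1 g1y)
    linarith
  have hy' : ∃ y' ∈ T0'.outline, g2 y' = 0 ∧ g1 y' < 0 := by
    rcases out_cases y hy with h | h
    · exact ⟨y, hABo' h, gy, g1y⟩
    · by_contra hc
      push Not at hc
      rw [FF_swap] at h
      refine propC g2 (fun z => ¬ g1 z < 0) ?_ (fun k => bad (Or.inl k)) (fun k => bad (Or.inr k))
        ?_ h gy g1y
      · intro x y hs hx hy hn
        rw [← FF_swap] at hs
        rwa [← sgn x y hs hx hy]
      · rintro y (hy | hy) gy
        · exact not_lt.2 (hc y (hACo' hy) gy)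
        · exact not_lt.2 (hc y (hBCo' hy) gy)
  have hz' : ∃ z' ∈ T0'.outline, g2 z' = 0 ∧ 0 < g1 z' := by
    rcases out_cases z hz with h | h
    · exact ⟨z, hABo' h, gz, g1z⟩
    · by_contra hc
      push Not at hc
      have key : ∀ y ∈ FF A B C C', g2 y = 0 → g1 y ≤ 0 → g1 y < 0 := fun y hy gy h =>
        lt_of_le_of_ne h (F12 y hy gy)
      rw [FF_swap] at h
      refine absurd (propC g2 (fun z => g1 z < 0) ?_ (fun k => bad (Or.inl k))
        (fun k => bad (Or.inr k)) ?_ h gz) (not_lt.2 g1z.le)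
      · intro x y hs hx hy hn
        rw [← FF_swap] at hs
        rwa [← sgn x y hs hx hy]
      · rintro y (hy | hy) gy
        · exact key y (fAC' hy) gy (hc y (hACo' hy) gy)
        · exact key y (fBC' hy) gy (hc y (hBCo' hy) gy)
  obtain ⟨y', hy', gy', g1y'⟩ := hy'
  obtain ⟨z', hz', gz', g1z'⟩ := hz'
  have ky := outline_sub_hull _ hy'
  have kz := outline_sub_hull _ hz'
  obtain ⟨X, hX, gX1⟩ := seg_ivt g1 (Or.inr ⟨g1y'.le, g1z'.le⟩)
  have gX2 := seg_zero_of_zero g2 gy' gz' hX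
  have X0 : X ∈ T0'.hull := (convex_convexHull ℝ _).segment_subset ky kz hX
  have X1 : X ∈ T1.hull := (D1.hull X).2 ⟨gX1, (W01' X X0 gX1).le⟩
  have mX := W12 X X1 gX2
  have X2 : X ∈ T2.hull := (D2.hull X).2 ⟨gX2, mX.le⟩
  have X2n : X ∉ T2.outline := fun h => by
    have := ((D2.out X).1 h).2
    linarith
  have gX0 := ((D0'.hull X).1 X0).1
  refine ⟨⟨X, ⟨X0, X1⟩, X2⟩, ?_, ?_⟩
  · obtain ⟨P, Q, hne, h⟩ := mixed_hull T0' g1 ky kz g1y' g1z'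
    refine ⟨P, Q, hne, ?_⟩
    rw [← h]
    ext x
    constructor
    · rintro ⟨a, b⟩
      exact ⟨a, ((D1.hull x).1 b).1⟩
    · rintro ⟨a, b⟩
      exact ⟨a, (D1.hull x).2 ⟨b, (W01' x (outline_sub_hull _ a) b).le⟩⟩
  · have sub : ∀ x ∈ T2.hull, g0' x = 0 → x ∈ T0'.hull := by
      intro x hx gx
      refine D0'.prop gX0 gx ?_ X0
      intro w hw hw'
      exact out2' w hw' ((convex_convexHull ℝ _).segment_subset X2 hx hw)
    have notflat : ¬ ∀ x ∈ T2.hull, g0' x = 0 := by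
      intro hf
      have hU : U ∈ T1.outline ∩ T2.hull := by rw [e12]; simp
      have hU0 := sub U hU.2 (hf U hU.2)
      have hU1 := (D1.out U).1 hU.1
      have := W01' U hU0 hU1.1
      linarith [hU1.2]
    obtain ⟨P, Q, hne, h⟩ := mixed T2 g0'
      (fun ⟨a, b, c⟩ => notflat (flat_of_nonneg T2 g0' X2 X2n gX0 a b c))
      (fun ⟨a, b, c⟩ => notflat (by
        simpa using flat_of_nonneg T2 (-g0') X2 X2n (by simpa using gX0) (by simpa using a)
          (by simpa using b) (by simpa using c)))
    refine ⟨P, Q, hne, ?_⟩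
    rw [← h]
    ext x
    constructor
    · rintro ⟨a, b⟩
      exact ⟨a, ((D0'.hull x).1 b).1⟩
    · rintro ⟨a, b⟩
      exact ⟨a, sub x (outline_sub_hull _ a) b⟩

theorem fin3_cases : ∀ j k : Fin 3, j = k ∨ j = k + 1 ∨ j = k + 2 := by decide

theorem inter_perm (T : Fin 3 → Tri) (e : Equiv.Perm (Fin 3)) (k : Fin 3) :
    (T 0).hull ∩ (T 1).hull ∩ (T 2).hull =
      (T (e k)).hull ∩ (T (e (k + 1))).hull ∩ (T (e (k + 2))).hull := by
  ext x
  have h1 : x ∈ (T 0).hull ∩ (T 1).hull ∩ (T 2).hull ↔ ∀ i, x ∈ (T i).hull := by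
    simp [Fin.forall_fin_succ, and_assoc]
  rw [h1]
  constructor
  · intro h
    exact ⟨⟨h _, h _⟩, h _⟩
  · rintro ⟨⟨a, b⟩, c⟩ i
    obtain ⟨j, rfl⟩ := e.surjective i
    have : j = k ∨ j = k + 1 ∨ j = k + 2 := fin3_cases j k
    rcases this with rfl | rfl | rfl <;> assumption

theorem back {T T' : Fin 3 → Tri} (h : ElemMove T T') (hL : IsLinking T') (hB : IsBorromean T') :
    IsLinking T ∧ IsBorromean T := by
  obtain ⟨i, A, B, C, C', hi, hi', -, hj⟩ := h
  have hF : ∀ j, j ≠ i → ∀ x ∈ FF A B C' C, x ∉ (T' j).outline := by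
    intro j hne x hx hx'
    rw [FF_swap] at hx
    have := (hj j hne).1
    rw [(hj j hne).2] at hx'
    have hh : x ∈ (∅ : Set Pt) := by rw [← this]; exact ⟨hx, hx'⟩
    exact hh
  have heq : ∀ j, j ≠ i → T' j = T j := fun j hne => (hj j hne).2
  have dis : ∀ j, j ≠ i → Disjoint (T i).outline (T j).outline := by
    intro j hne
    rw [← heq j hne, Set.disjoint_left]
    intro x hx hx'
    rw [outline_eq hi] at hx
    rcases hx with (hx | hx) | hx
    · have : x ∈ (T' i).outline := by rw [outline_eq hi']; exact Or.inl (Or.inl hx)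
      exact Set.disjoint_left.1 (hL i j hne.symm) this hx'
    · refine hF j hne x (Or.inr ?_) hx'
      exact (convex_convexHull ℝ _).segment_subset (subset_convexHull _ _ (by simp))
        (subset_convexHull _ _ (by simp)) hx
    · refine hF j hne x (Or.inl ?_) hx'
      exact (convex_convexHull ℝ _).segment_subset (subset_convexHull _ _ (by simp))
        (subset_convexHull _ _ (by simp)) hx
  refine ⟨?_, ?_⟩
  · intro j k hjk
    by_cases h1 : j = i
    · subst h1; exact dis k hjk.symm
    · by_cases h2 : k = i
      · subst h2; exact (dis j hjk).symm
      · rw [← heq j h1, ← heq k h2]; exact hL j k hjk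
  · obtain ⟨hO, e, he⟩ := hB
    obtain ⟨k, rfl⟩ := e.surjective i
    have k1 : k + 1 ≠ k := by clear * -; decide +revert
    have k2 : k + 2 ≠ k := by clear * -; decide +revert
    have k12 : k + 1 ≠ k + 2 := by clear * -; decide +revert
    have s1 : k + 1 + 1 = k + 2 := by clear * -; decide +revert
    have s2 : k + 2 + 1 = k := by clear * -; decide +revert
    have n1 : e (k + 1) ≠ e k := e.injective.ne k1
    have n2 : e (k + 2) ≠ e k := e.injective.ne k2
    have n12 : e (k + 1) ≠ e (k + 2) := e.injective.ne k12
    rw [inter_perm T' e k] at hO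
    have q0 := he k
    have q1 := he (k + 1)
    have q2 := he (k + 2)
    rw [s1] at q1
    rw [s2] at q2
    obtain ⟨r0, r1, r2⟩ := step hi' hi (hF _ n1) (hF _ n2) (hL _ _ n1.symm) (hL _ _ n12)
      (hL _ _ n2) hO q0 q1 q2
    rw [heq _ n1] at r0 r1 q1
    rw [heq _ n2] at r0 r2 q1
    refine ⟨by rw [inter_perm T e k]; exact r0, e, ?_⟩
    intro j
    have : j = k ∨ j = k + 1 ∨ j = k + 2 := fin3_cases j k
    rcases this with rfl | rfl | rfl
    · exact r1
    · rw [s1]; exact q1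
    · rw [s2]; exact r2

/-- A linking of three triangles combinatorially isotopic to a Borromean linking is itself
Borromean. -/
theorem stmt4 (T T' : Fin 3 → Tri) (hT : IsLinking T) (hT' : IsLinking T')
    (hB : IsBorromean T') (h : CombIsotopic T T') :
    IsBorromean T := by
  have key : IsLinking T ∧ IsBorromean T := by
    clear hT
    unfold CombIsotopic at h
    induction h using Relation.ReflTransGen.head_induction_on with
    | refl => exact ⟨hT', hB⟩
    | head h1 _ ih => exact back h1 ih.1 ih.2
  exact key.2
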